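/- Let χ be a bicharacter on ℤ^I with values in 𝕜∖{0} and p ∈ I such that χ is p-finite; write c_{pi} = c^χ_{pi}, χ̄ = r_p(χ) and q̄_{ij} = χ̄(ε_i,ε_j). Then: (a) λ_i(χ̄) := [−c_{pi}]_{q̄_pp}! · ∏_{s=0}^{−c_{pi}−1}(q̄_pp^s q̄_{pi} q̄_{ip} − 1) ≠ 0 for every i ∈ I∖{p}; and (b) there is a unique algebra homomorphism T_p : 𝒰(χ) → 𝒰(χ̄)/J such that T_p(K_p) = [K̄_p^{−1}], T_p(L_p) = [L̄_p^{−1}], T_p(K_i) = [K̄_iK̄_p^{−c_{pi}}], T_p(L_i) = [L̄_iL̄_p^{−c_{pi}}] for i ≠ p, T_p(E_p) = [F̄_pL̄_p^{−1}], T_p(F_p) = [K̄_p^{−1}Ē_p], and T_p(E_i) = [Ē^+_{i,−c_{pi}}], T_p(F_i) = λ_i(χ̄)^{−1}·[F̄^+_{i,−c_{pi}}] for i ≠ p, where bars denote the generators and the elements Ē^+_{i,m}, F̄^+_{i,m} of 𝒰(χ̄), and [·] denotes the image in 𝒰(χ̄)/J. -/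

import Mathlib

/-- The quantum integer `[n]_q = 1 + q + ⋯ + q^{n-1}` for `n ∈ ℕ`. -/
def qNat {𝕜 : Type*} [Field 𝕜] (q : 𝕜) (n : ℕ) : 𝕜 :=
  ∑ i ∈ Finset.range n, q ^ i

/-- The quantum factorial `[n]_q! = [1]_q [2]_q ⋯ [n]_q`. -/
def qFact {𝕜 : Type*} [Field 𝕜] (q : 𝕜) (n : ℕ) : 𝕜 :=
  ∏ i ∈ Finset.range n, qNat q (i + 1)

variable {𝕜 : Type*} [Field 𝕜] {I : Type*} [Fintype I] [DecidableEq I]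

/-- The standard basis vector `ε_i` of `ℤ^I`. -/
def eps (i : I) : I → ℤ := Pi.single i 1

/-- `χ : ℤ^I × ℤ^I → 𝕜∖{0}` is a bicharacter. -/
def IsBichar (χ : (I → ℤ) → (I → ℤ) → 𝕜) : Prop :=
  (∀ a b c : I → ℤ, χ (a + b) c = χ a c * χ b c) ∧
  (∀ c a b : I → ℤ, χ c (a + b) = χ c a * χ c b) ∧
  (∀ a b : I → ℤ, χ a b ≠ 0)

/-- `χ` is `p`-finite: for every `j ≠ p` there is `m ∈ ℕ₀` with
`[m+1]_{q_{pp}} = 0` or `q_{pp}^m q_{pj} q_{jp} = 1`. -/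
def IsPFinite (χ : (I → ℤ) → (I → ℤ) → 𝕜) (p : I) : Prop :=
  ∀ j, j ≠ p → ∃ m : ℕ,
    qNat (χ (eps p) (eps p)) (m + 1) = 0 ∨
    χ (eps p) (eps p) ^ m * χ (eps p) (eps j) * χ (eps j) (eps p) = 1

open Classical in
/-- The Cartan integers `c^χ_{pj}` of a (`p`-finite) bicharacter `χ`. -/
noncomputable def cartan (χ : (I → ℤ) → (I → ℤ) → 𝕜) (p j : I) : ℤ :=
  if p = j then 2
  else if h : ∃ m : ℕ,
      qNat (χ (eps p) (eps p)) (m + 1) = 0 ∨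
      χ (eps p) (eps p) ^ m * χ (eps p) (eps j) * χ (eps j) (eps p) = 1
    then -(Nat.find h) else 0

/-- The reflection `σ_p^χ ∈ Aut(ℤ^I)`, `σ_p^χ(ε_j) = ε_j − c^χ_{pj} ε_p`
(an involution, so equal to its own inverse). -/
noncomputable def sigmaChi (χ : (I → ℤ) → (I → ℤ) → 𝕜) (p : I) (a : I → ℤ) : I → ℤ :=
  a - (∑ j, cartan χ p j * a j) • eps p

/-- `r_p(χ) = (σ_p^χ)^*χ`, i.e. `r_p(χ)(a,b) = χ((σ_p^χ)⁻¹ a, (σ_p^χ)⁻¹ b)`. -/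
noncomputable def rp (χ : (I → ℤ) → (I → ℤ) → 𝕜) (p : I) :
    (I → ℤ) → (I → ℤ) → 𝕜 :=
  fun a b => χ (sigmaChi χ p a) (sigmaChi χ p b)
/-- The generators `K_i, K_i⁻¹, L_i, L_i⁻¹, E_i, F_i` of `𝒰(χ)`. -/
inductive UGen (I : Type*) where
  | K (i : I)
  | Kinv (i : I)
  | L (i : I)
  | Linv (i : I)
  | E (i : I)
  | F (i : I)

/-- The toral generators are `K_i, K_i⁻¹, L_i, L_i⁻¹`. -/
def UGen.IsToral {I : Type*} : UGen I → Prop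
  | .K _ => True
  | .Kinv _ => True
  | .L _ => True
  | .Linv _ => True
  | _ => False

variable (𝕜) in
/-- The defining relations of the Drinfel'd double `𝒰(χ)`:
all `K_i^{±1}, L_j^{±1}` commute pairwise; `K_iK_i⁻¹ = 1 = L_iL_i⁻¹`;
`K_iE_j = q_{ij}E_jK_i`, `L_iE_j = q_{ji}⁻¹E_jL_i`, `K_iF_j = q_{ij}⁻¹F_jK_i`,
`L_iF_j = q_{ji}F_jL_i`; `E_iF_j − F_jE_i = δ_{ij}(K_i − L_i)`. -/
inductive URel (χ : (I → ℤ) → (I → ℤ) → 𝕜) :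
    FreeAlgebra 𝕜 (UGen I) → FreeAlgebra 𝕜 (UGen I) → Prop
  | comm (x y : UGen I) (hx : x.IsToral) (hy : y.IsToral) :
      URel χ (FreeAlgebra.ι 𝕜 x * FreeAlgebra.ι 𝕜 y)
        (FreeAlgebra.ι 𝕜 y * FreeAlgebra.ι 𝕜 x)
  | KKinv (i : I) :
      URel χ (FreeAlgebra.ι 𝕜 (.K i) * FreeAlgebra.ι 𝕜 (.Kinv i)) 1
  | LLinv (i : I) :
      URel χ (FreeAlgebra.ι 𝕜 (.L i) * FreeAlgebra.ι 𝕜 (.Linv i)) 1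
  | KE (i j : I) :
      URel χ (FreeAlgebra.ι 𝕜 (.K i) * FreeAlgebra.ι 𝕜 (.E j))
        (χ (eps i) (eps j) • (FreeAlgebra.ι 𝕜 (.E j) * FreeAlgebra.ι 𝕜 (.K i)))
  | LE (i j : I) :
      URel χ (FreeAlgebra.ι 𝕜 (.L i) * FreeAlgebra.ι 𝕜 (.E j))
        ((χ (eps j) (eps i))⁻¹ • (FreeAlgebra.ι 𝕜 (.E j) * FreeAlgebra.ι 𝕜 (.L i)))
  | KF (i j : I) :
      URel χ (FreeAlgebra.ι 𝕜 (.K i) * FreeAlgebra.ι 𝕜 (.F j))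
        ((χ (eps i) (eps j))⁻¹ • (FreeAlgebra.ι 𝕜 (.F j) * FreeAlgebra.ι 𝕜 (.K i)))
  | LF (i j : I) :
      URel χ (FreeAlgebra.ι 𝕜 (.L i) * FreeAlgebra.ι 𝕜 (.F j))
        (χ (eps j) (eps i) • (FreeAlgebra.ι 𝕜 (.F j) * FreeAlgebra.ι 𝕜 (.L i)))
  | EF (i j : I) :
      URel χ (FreeAlgebra.ι 𝕜 (.E i) * FreeAlgebra.ι 𝕜 (.F j) -
          FreeAlgebra.ι 𝕜 (.F j) * FreeAlgebra.ι 𝕜 (.E i))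
        (if i = j then FreeAlgebra.ι 𝕜 (.K i) - FreeAlgebra.ι 𝕜 (.L i) else 0)

/-- The Drinfel'd double `𝒰(χ)`, presented by generators and relations. -/
abbrev UAlg (χ : (I → ℤ) → (I → ℤ) → 𝕜) : Type _ := RingQuot (URel 𝕜 χ)

variable (χ : (I → ℤ) → (I → ℤ) → 𝕜)

/-- The canonical projection from the free algebra onto `𝒰(χ)`. -/
noncomputable def mkU : FreeAlgebra 𝕜 (UGen I) →ₐ[𝕜] UAlg χ :=
  RingQuot.mkAlgHom 𝕜 (URel 𝕜 χ)

/-- The generator `K_i` of `𝒰(χ)`. -/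
noncomputable def uK (i : I) : UAlg χ := mkU χ (FreeAlgebra.ι 𝕜 (.K i))
/-- The generator `K_i⁻¹` of `𝒰(χ)`. -/
noncomputable def uKinv (i : I) : UAlg χ := mkU χ (FreeAlgebra.ι 𝕜 (.Kinv i))
/-- The generator `L_i` of `𝒰(χ)`. -/
noncomputable def uL (i : I) : UAlg χ := mkU χ (FreeAlgebra.ι 𝕜 (.L i))
/-- The generator `L_i⁻¹` of `𝒰(χ)`. -/
noncomputable def uLinv (i : I) : UAlg χ := mkU χ (FreeAlgebra.ι 𝕜 (.Linv i))
/-- The generator `E_i` of `𝒰(χ)`. -/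
noncomputable def uE (i : I) : UAlg χ := mkU χ (FreeAlgebra.ι 𝕜 (.E i))
/-- The generator `F_i` of `𝒰(χ)`. -/
noncomputable def uF (i : I) : UAlg χ := mkU χ (FreeAlgebra.ι 𝕜 (.F i))

/-- The general recursion `Y_0 = Y`, `Y_{m+1} = X Y_m − α β^m Y_m X`; with
`X = E_p`, `Y = E_i`, `α = q_{pi}`, `β = q_{pp}` this gives `E^+_{i,m}`, and
with `X = F_p`, `Y = F_i`, `α = q_{ip}`, `β = q_{pp}` it gives `F^+_{i,m}`. -/
def recE {A : Type*} [Ring A] [Algebra 𝕜 A] (α β : 𝕜) (X Y : A) : ℕ → A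
  | 0 => Y
  | m + 1 => X * recE α β X Y m - (α * β ^ m) • (recE α β X Y m * X)

/-- `λ_i(χ') = [n]_{q'_{pp}}! ⬝ ∏_{s=0}^{n−1} (q'_{pp}^s q'_{pi} q'_{ip} − 1)`,
where `n = −c_{pi}`. -/
noncomputable def lamOf (χ' : (I → ℤ) → (I → ℤ) → 𝕜) (p i : I) (n : ℕ) : 𝕜 :=
  qFact (χ' (eps p) (eps p)) n *
    ∏ s ∈ Finset.range n,
      (χ' (eps p) (eps p) ^ s * χ' (eps p) (eps i) * χ' (eps i) (eps p) - 1)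

open Classical in
/-- The generating set of the ideal
`J = (I_p^+(χ'), I_p^-(χ'))` of `𝒰(χ')`: if `h = min{m ∈ ℕ : [m]_{q'_{pp}} = 0}`
exists, the generators are `E_p^h`, `F_p^h` and the `E^+_{i,1−c_{pi}}`,
`F^+_{i,1−c_{pi}}` with `i ≠ p` and `1−c_{pi} < h`; otherwise they are the
`E^+_{i,1−c_{pi}}`, `F^+_{i,1−c_{pi}}` with `i ≠ p`.  Here `c : I → ℤ`
records the Cartan integers `c_{pi}`. -/
noncomputable def genSet (χ' : (I → ℤ) → (I → ℤ) → 𝕜) (p : I) (c : I → ℤ) :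
    Set (UAlg χ') :=
  if h : ∃ m : ℕ, 0 < m ∧ qNat (χ' (eps p) (eps p)) m = 0 then
    {uE χ' p ^ Nat.find h, uF χ' p ^ Nat.find h} ∪
    {x | ∃ i, i ≠ p ∧ ((1 : ℤ) - c i).toNat < Nat.find h ∧
      (x = recE (χ' (eps p) (eps i)) (χ' (eps p) (eps p)) (uE χ' p) (uE χ' i)
          ((1 : ℤ) - c i).toNat ∨
       x = recE (χ' (eps i) (eps p)) (χ' (eps p) (eps p)) (uF χ' p) (uF χ' i)
          ((1 : ℤ) - c i).toNat)}
  else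
    {x | ∃ i, i ≠ p ∧
      (x = recE (χ' (eps p) (eps i)) (χ' (eps p) (eps p)) (uE χ' p) (uE χ' i)
          ((1 : ℤ) - c i).toNat ∨
       x = recE (χ' (eps i) (eps p)) (χ' (eps p) (eps p)) (uF χ' p) (uF χ' i)
          ((1 : ℤ) - c i).toNat)}

/-- The relation whose `RingQuot` is the quotient of `𝒰(χ')` by the two-sided
ideal generated by `genSet χ' p c`. -/
def JRel (χ' : (I → ℤ) → (I → ℤ) → 𝕜) (p : I) (c : I → ℤ) :
    UAlg χ' → UAlg χ' → Prop :=
  fun x y => x ∈ genSet χ' p c ∧ y = 0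

/-- The quotient algebra `𝒰(χ')/(I_p^+(χ'), I_p^-(χ'))`. -/
abbrev UQuot (χ' : (I → ℤ) → (I → ℤ) → 𝕜) (p : I) (c : I → ℤ) : Type _ :=
  RingQuot (JRel χ' p c)

/-- The canonical projection `𝒰(χ') → 𝒰(χ')/(I_p^+(χ'), I_p^-(χ'))`. -/
noncomputable def mkJ (χ' : (I → ℤ) → (I → ℤ) → 𝕜) (p : I) (c : I → ℤ) :
    UAlg χ' →ₐ[𝕜] UQuot χ' p c :=
  RingQuot.mkAlgHom 𝕜 (JRel χ' p c)


section core
variable {B : Type*} [Ring B] [Algebra 𝕜 B]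


theorem qNat_succ' (q : 𝕜) (n : ℕ) : qNat q (n + 1) = q * qNat q n + 1 := by
  unfold qNat
  rw [Finset.sum_range_succ', Finset.mul_sum]
  simp [pow_succ']

theorem qNat_succ (q : 𝕜) (n : ℕ) : qNat q (n + 1) = qNat q n + q ^ n := by
  unfold qNat
  rw [Finset.sum_range_succ]

/-- `x` and `y` commute up to the scalar `c`. -/
def QC (c : 𝕜) (x y : B) : Prop := x * y = c • (y * x)

theorem QC.mul_right {c d : 𝕜} {x y z : B} (h : QC c x y) (h' : QC d x z) :
    QC (c * d) x (y * z) := by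
  unfold QC at *
  rw [← mul_assoc, h, smul_mul_assoc, mul_assoc, h', mul_smul_comm, smul_smul, mul_assoc]

theorem QC.mul_left {c d : 𝕜} {x y z : B} (h : QC c x z) (h' : QC d y z) :
    QC (c * d) (x * y) z := by
  unfold QC at *
  rw [mul_assoc, h', mul_smul_comm, ← mul_assoc, h, smul_mul_assoc, smul_smul, mul_assoc,
    mul_comm c d]

theorem QC.one_right (x : B) : QC (1 : 𝕜) x 1 := by simp [QC]
theorem QC.one_left (x : B) : QC (1 : 𝕜) 1 x := by simp [QC]

theorem QC.pow_right {c : 𝕜} {x y : B} (h : QC c x y) (n : ℕ) : QC (c ^ n) x (y ^ n) := by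
  induction n with
  | zero => simpa using QC.one_right x
  | succ n ih => rw [pow_succ, pow_succ]; exact ih.mul_right h

theorem QC.pow_left {c : 𝕜} {x y : B} (h : QC c x y) (n : ℕ) : QC (c ^ n) (x ^ n) y := by
  induction n with
  | zero => simpa using QC.one_left y
  | succ n ih => rw [pow_succ, pow_succ]; exact ih.mul_left h

theorem QC.smul_right {c : 𝕜} {x y : B} (h : QC c x y) (a : 𝕜) : QC c x (a • y) := by
  unfold QC at *
  rw [mul_smul_comm, h, smul_mul_assoc, smul_comm]

theorem QC.sub_right {c : 𝕜} {x y z : B} (h : QC c x y) (h' : QC c x z) :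
    QC c x (y - z) := by
  unfold QC at *
  rw [mul_sub, h, h', sub_mul, smul_sub]

theorem QC.symm {c : 𝕜} (hc : c ≠ 0) {x y : B} (h : QC c x y) : QC c⁻¹ y x := by
  unfold QC at *
  rw [h, smul_smul, inv_mul_cancel₀ hc, one_smul]

theorem QC.inv_left {c : 𝕜} (hc : c ≠ 0) {x x' y : B} (h : QC c x y) (h1 : x * x' = 1)
    (h2 : x' * x = 1) : QC c⁻¹ x' y := by
  unfold QC at *
  have h3 : y * x' = c • (x' * y) := by
    calc y * x' = x' * (x * y) * x' := by rw [← mul_assoc x', h2, one_mul]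
      _ = c • (x' * y) := by rw [h, mul_smul_comm, smul_mul_assoc, mul_assoc, mul_assoc, h1, mul_one]
  rw [h3, smul_smul, inv_mul_cancel₀ hc, one_smul]

theorem QC.of_comm {x y : B} (h : x * y = y * x) : QC (1 : 𝕜) x y := by simp [QC, h]

theorem QC.recE {c a : 𝕜} {x X Y : B} (α β : 𝕜) (hX : QC a x X) (hY : QC c x Y) (m : ℕ) :
    QC (c * a ^ m) x (recE α β X Y m) := by
  induction m with
  | zero => simpa [_root_.recE] using hY
  | succ m ih =>
    have h1 := hX.mul_right ih
    have h2 := ih.mul_right hX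
    have e1 : a * (c * a ^ m) = c * a ^ (m + 1) := by ring
    have e2 : (c * a ^ m) * a = c * a ^ (m + 1) := by ring
    rw [e1] at h1
    rw [e2] at h2
    exact h1.sub_right (h2.smul_right _)

theorem recE_succ (α β : 𝕜) (X Y : B) (m : ℕ) :
    recE α β X Y (m + 1) = X * recE α β X Y m - (α * β ^ m) • (recE α β X Y m * X) := rfl

theorem recE_comm {x X Y : B} (α β : 𝕜) (hX : x * X = X * x) (hY : x * Y = Y * x) (m : ℕ) :
    x * recE α β X Y m = recE α β X Y m * x := by
  have := QC.recE (𝕜 := 𝕜) α β (QC.of_comm hX) (QC.of_comm hY) m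
  simpa [QC] using this

theorem core1 {a b q : 𝕜} {K L E F Y : B} (hEF : E * F - F * E = K - L)
    (hKY : QC a K Y) (hKE : QC q K E) (hYL : QC b Y L) (hEL : QC q E L)
    (hb : b ≠ 0) (hq : q ≠ 0)
    (hYF : F * Y = Y * F) (m : ℕ) :
    recE a q E Y (m + 1) * F - F * recE a q E Y (m + 1) =
      (qNat q (m + 1) * (q ^ m * a * b - 1)) • (L * recE a q E Y m) := by
  have hLm : ∀ m, QC (b * q ^ m) (recE a q E Y m) L := fun m => by
    have := (QC.recE a q (hEL.symm hq) (hYL.symm hb) m).symm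
      (by positivity)
    convert this using 1
    rw [mul_inv, inv_pow, inv_inv, inv_inv]
  have hKm : ∀ m, QC (a * q ^ m) K (recE a q E Y m) := QC.recE a q hKE hKY
  induction m with
  | zero =>
    have h1 := hKm 0
    have h2 := hLm 0
    simp only [QC, recE, pow_zero, mul_one] at h1 h2 ⊢
    simp only [qNat]
    linear_combination (norm := skip) hEF * Y - a • (Y * hEF) + h1 + a • h2 + E * hYF.symm
      + a • (hYF * E)
    simp [mul_sub, sub_mul, mul_assoc]
    module
  | succ m ih =>
    have h1 := hKm (m + 1)
    have h2 := hLm (m + 1)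
    rw [recE_succ (m := m + 1)]
    have h3 := recE_succ a q E Y m
    generalize recE a q E Y (m + 1) = Z at *
    generalize recE a q E Y m = W at *
    unfold QC at *
    linear_combination (norm := skip) E * ih - (a * q ^ (m + 1)) • (ih * E) + h1
      + hEF * Z - (a * q ^ (m+1)) • (Z * hEF) + (a * q ^ (m+1)) • h2
      + (qNat q (m + 1) * (q ^ m * a * b - 1)) • (hEL * W)
      - ((qNat q (m + 1) * (q ^ m * a * b - 1)) * q) • (L * h3)
    rw [qNat_succ' q (m+1)]
    have e : qNat q (m+1) = q * qNat q m + 1 := qNat_succ' q m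
    have e' : q ^ (m+1) = (q-1) * qNat q (m+1) + 1 := by
      have := qNat_succ q (m+1)
      rw [qNat_succ'] at this
      linear_combination - this
    have e'' : (a * q ^ (m+1) * (b * q ^ (m+1)) - 1) = (q * qNat q (m+1) + 1) * (q ^ (m+1) * a * b - 1) - q * (qNat q (m+1) * (q ^ m * a * b - 1)) := by
      linear_combination (a * b * q^(m+1)) * e'
    simp only [mul_sub, sub_mul, mul_assoc, smul_mul_assoc, mul_smul_comm, smul_sub, smul_smul]
    linear_combination (norm := module) (e'') • (L * Z)

theorem core2 {a b q a' : 𝕜} {K L E F Y Z : B} (hEF : E * F - F * E = K - L)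
    (hKY : QC a K Y) (hKE : QC q K E)
    (hLF : QC q L F) (hFK : QC q F K) (hLZ : QC b L Z) (hZK : QC a' Z K)
    (ha' : a' ≠ 0) (hq : q ≠ 0)
    (hYF : F * Y = Y * F) (hEZ : E * Z = Z * E) (hYZ : Y * Z = Z * Y) (m l : ℕ) :
    recE a q E Y m * recE b q F Z l = recE b q F Z l * recE a q E Y m := by
  induction m generalizing l with
  | zero => exact recE_comm b q hYF.symm hYZ l
  | succ m ih =>
    have hK := QC.recE a q hKE hKY m
    rw [recE_succ]
    rcases l with _ | l
    · have i0 := ih 0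
      simp only [recE] at i0 ⊢
      linear_combination (norm := skip) E * i0 + hEZ * recE a q E Y m
        - (a * q ^ m) • (i0 * E + recE a q E Y m * hEZ)
      simp only [mul_sub, sub_mul, mul_add, add_mul, mul_assoc, smul_mul_assoc, mul_smul_comm, smul_sub, smul_smul]
      module
    · have i0 := ih l
      have i1 := ih (l + 1)
      have h := core1 (K := L) (L := K) (E := F) (F := E) (Y := Z)
        (by linear_combination (norm := module) - hEF) hLZ hLF hZK hFK ha' hq hEZ l
      generalize qNat q (l + 1) * (q ^ l * b * a' - 1) = s at *
      generalize recE b q F Z (l + 1) = U at *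
      generalize recE b q F Z l = V at *
      generalize recE a q E Y m = W at *
      unfold QC at hK
      linear_combination (norm := skip) E * i1 - h * W
        - (a * q ^ m) • (i1 * E - W * h) - s • (hK * V) + s • (K * i0)
      simp only [mul_sub, sub_mul, mul_add, add_mul, mul_assoc, smul_mul_assoc, mul_smul_comm, smul_sub, smul_smul]
      module

theorem pow_comm_core {q : 𝕜} {K L E F : B} (hEF : E * F - F * E = K - L)
    (hLF : QC q L F) (hFK : QC q F K) (d : ℕ) :
    E * F ^ (d + 1) - F ^ (d + 1) * E = qNat q (d + 1) • (K * F ^ d - F ^ d * L) := by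
  induction d with
  | zero => simpa [qNat] using hEF
  | succ d ih =>
    have h := hFK.pow_left (d + 1)
    rw [qNat_succ']
    have e : q ^ (d+1) = (q-1) * qNat q (d+1) + 1 := by
      have := qNat_succ q (d+1)
      rw [qNat_succ'] at this
      linear_combination - this
    rw [e] at h
    have e2 : F ^ (d + 1 + 1) = F ^ (d + 1) * F := pow_succ _ _
    have e3 : F ^ (d + 1) = F ^ d * F := pow_succ _ _
    rw [e2]
    unfold QC at h hLF
    linear_combination (norm := skip) ih * F + F ^ (d+1) * hEF + h
      - (qNat q (d + 1)) • (F ^ d * hLF)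
      - (qNat q (d + 1)) • (K * e3) + (q * qNat q (d + 1)) • (e3 * L)
    simp only [mul_sub, sub_mul, mul_assoc, smul_mul_assoc, mul_smul_comm, smul_sub, smul_smul]
    module

/-- Falling quantum factorial. -/
def qDesc (q : 𝕜) (l m : ℕ) : 𝕜 := ∏ s ∈ Finset.range m, qNat q (l - s)

theorem qDesc_succ (q : 𝕜) (l m : ℕ) : qDesc q l (m + 1) = qDesc q l m * qNat q (l - m) :=
  Finset.prod_range_succ _ _

theorem qDesc_succ' (q : 𝕜) (l m : ℕ) :
    qDesc q (l + 1) (m + 1) = qNat q (l + 1) * qDesc q l m := by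
  unfold qDesc
  rw [Finset.prod_range_succ', mul_comm]
  simp

theorem qFact_succ (q : 𝕜) (m : ℕ) : qFact q (m + 1) = qFact q m * qNat q (m + 1) :=
  Finset.prod_range_succ _ _

theorem qDesc_self (q : 𝕜) (m : ℕ) : qDesc q m m = qFact q m := by
  induction m with
  | zero => simp [qDesc, qFact]
  | succ m ih => rw [qDesc_succ', ih, qFact_succ, mul_comm]

theorem qDesc_self' (q : 𝕜) (m : ℕ) : qDesc q (m + 1) m = qFact q (m + 1) := by
  have := qDesc_succ q (m + 1) m
  rw [qDesc_self] at this
  simp [this, qNat]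

/-- The product `∏_{s<l} (q^s a b - 1)`. -/
def qP (q a b : 𝕜) (l : ℕ) : 𝕜 := ∏ s ∈ Finset.range l, (q ^ s * a * b - 1)

theorem qP_succ (q a b : 𝕜) (l : ℕ) : qP q a b (l + 1) = qP q a b l * (q ^ l * a * b - 1) :=
  Finset.prod_range_succ _ _

theorem core3_base {a b q : 𝕜} {F Y Z Ki Li : B}
    (hYF : F * Y = Y * F) (hYZ : Y * Z - Z * Y = Ki - Li)
    (hFKi : QC b F Ki) (hLiF : QC a Li F) (l : ℕ) :
    Y * recE b q F Z (l + 1) - recE b q F Z (l + 1) * Y =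
      ((-1) ^ l * qP q a b (l + 1)) • (F ^ (l + 1) * Li) := by
  induction l with
  | zero =>
    simp only [recE, qP]
    unfold QC at *
    linear_combination (norm := skip) F * hYZ - b • (hYZ * F) - hYF * Z + b • (Z * hYF) + hFKi
      + b • hLiF
    simp [mul_sub, sub_mul, mul_assoc, smul_mul_assoc, mul_smul_comm, smul_sub, smul_smul]
    module
  | succ l ih =>
    rw [recE_succ (m := l + 1), qP_succ]
    have h := congrArg (F ^ (l + 1) * ·) hLiF
    have e2 : F ^ (l + 1 + 1) = F ^ (l + 1) * F := pow_succ _ _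
    have e3 : F ^ (l + 1 + 1) = F * F ^ (l + 1) := pow_succ' _ _
    generalize recE b q F Z (l + 1) = U at *
    generalize qP q a b (l + 1) = P at *
    unfold QC at *
    rw [pow_succ (-1 : 𝕜) l]
    linear_combination (norm := skip) F * ih - (b * q ^ (l + 1)) • (ih * F) - hYF * U +
      (b * q ^ (l + 1)) • (U * hYF) - (b * q ^ (l + 1)) • (((-1) ^ l * P) • h)
      - ((-1) ^ l * P) • (e3 * Li) 
      + ((b * q ^ (l + 1)) * (((-1) ^ l * P) * a)) • (e2 * Li)
    simp only [mul_sub, sub_mul, mul_assoc, smul_mul_assoc, mul_smul_comm, smul_sub, smul_smul]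
    module

theorem core3 {a b q : 𝕜} {K L E F Y Z Ki Li : B} (hEF : E * F - F * E = K - L)
    (hKY : QC a K Y) (hKE : QC q K E)
    (hLF : QC q L F) (hFK : QC q F K) (hLZ : QC b L Z) (hZK : QC a Z K)
    (ha : a ≠ 0) (hq : q ≠ 0)
    (hYF : F * Y = Y * F) (hEZ : E * Z = Z * E) (hYZ : Y * Z - Z * Y = Ki - Li)
    (hFKi : QC b F Ki) (hLiF : QC a Li F) (hELi : QC a E Li) (hEL : QC q E L)
    (hLLi : L * Li = Li * L) (hKKi : K * Ki = Ki * K) (m : ℕ) :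
    (∀ d, recE a q E Y m * recE b q F Z (m + d + 1) - recE b q F Z (m + d + 1) * recE a q E Y m
      = ((-1) ^ d * qP q a b (m + d + 1) * qDesc q (m + d + 1) m) • (F ^ (d + 1) * (Li * L ^ m))) ∧
    (recE a q E Y m * recE b q F Z m - recE b q F Z m * recE a q E Y m
      = (qFact q m * qP q a b m) • (Ki * K ^ m - Li * L ^ m)) := by
  induction m with
  | zero =>
    constructor
    · intro d
      have := core3_base (q := q) hYF hYZ hFKi hLiF d
      simpa [qDesc, recE] using this
    · simpa [qFact, qP, recE] using hYZ
  | succ m ih =>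
    obtain ⟨ih1, ih2⟩ := ih
    have hrec : ∀ l, recE a q E Y (m + 1) * recE b q F Z (l + 1)
        - recE b q F Z (l + 1) * recE a q E Y (m + 1) =
        E * (recE a q E Y m * recE b q F Z (l + 1) - recE b q F Z (l + 1) * recE a q E Y m)
        - (a * q ^ m) • ((recE a q E Y m * recE b q F Z (l + 1)
          - recE b q F Z (l + 1) * recE a q E Y m) * E)
        + (qNat q (l + 1) * (q ^ l * b * a - 1)) • (K *
          (recE a q E Y m * recE b q F Z l - recE b q F Z l * recE a q E Y m)) := by
      intro l
      have hK := QC.recE a q hKE hKY m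
      rw [recE_succ (m := m)]
      have h := core1 (K := L) (L := K) (E := F) (F := E) (Y := Z)
        (by linear_combination (norm := module) - hEF) hLZ hLF hZK hFK ha hq hEZ l
      generalize qNat q (l + 1) * (q ^ l * b * a - 1) = s at *
      generalize recE b q F Z (l + 1) = U at *
      generalize recE b q F Z l = V at *
      generalize recE a q E Y m = W at *
      unfold QC at hK
      linear_combination (norm := skip) - h * W
        + (a * q ^ m) • (W * h) - s • (hK * V)
      simp only [mul_sub, sub_mul, mul_assoc, smul_mul_assoc, mul_smul_comm, smul_sub, smul_smul]
      module
    have hN : QC (a * q ^ m) E (Li * L ^ m) := hELi.mul_right (hEL.pow_right m)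
    have hN' : L * (Li * L ^ m) = Li * L ^ (m + 1) := by
      rw [← mul_assoc, hLLi, mul_assoc, ← pow_succ']
    have hM' : K * (Ki * K ^ m) = Ki * K ^ (m + 1) := by
      rw [← mul_assoc, hKKi, mul_assoc, ← pow_succ']
    constructor
    · intro d
      have e1 : m + 1 + d + 1 = (m + d + 1) + 1 := by ring
      rw [e1, hrec, ih1 d]
      have := ih1 (d + 1)
      have e2 : m + (d + 1) + 1 = (m + d + 1) + 1 := by ring
      rw [e2] at this
      rw [this, ← hN']
      have hp := pow_comm_core hEF hLF hFK (d + 1)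
      have d1 := qDesc_succ q (m + d + 1 + 1) m
      have e3 : m + d + 1 + 1 - m = d + 1 + 1 := by omega
      rw [e3, qDesc_succ'] at d1
      rw [qP_succ, qDesc_succ']
      generalize qNat q (m + d + 1 + 1) = x at *
      generalize qP q a b (m + d + 1) = P at *
      generalize qDesc q (m + d + 1) m = D at *
      generalize qDesc q (m + d + 1 + 1) m = D' at *
      generalize m + d + 1 = l at *
      generalize Li * L ^ m = N at *
      unfold QC at hN
      linear_combination (norm := skip) ((-1) ^ (d + 1) * (P * (q ^ l * a * b - 1)) * D') • (hp * N)
        - ((-1) ^ (d + 1) * (P * (q ^ l * a * b - 1)) * D') • (F ^ (d + 1 + 1) * hN.symm)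
        - ((-1) ^ (d + 1) * (P * (q ^ l * a * b - 1))) • (d1 • (K * (F ^ (d + 1) * N) - F ^ (d+1) * (L * N)))
      simp only [mul_sub, sub_mul, mul_assoc, smul_mul_assoc, mul_smul_comm, smul_sub, smul_smul]
      module
    · have i1 := ih1 0
      simp only [pow_zero, one_mul, add_zero, zero_add, pow_one] at i1
      rw [hrec, i1, ih2, ← hN', ← hM', qDesc_self', qP_succ, qFact_succ]
      generalize Li * L ^ m = N at *
      unfold QC at hN
      linear_combination (norm := skip) (qFact q m * qNat q (m+1) * (qP q a b m * (q ^ m * a * b - 1))) •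
         (hEF * N - F * hN.symm)
      simp only [mul_sub, sub_mul, mul_assoc, smul_mul_assoc, mul_smul_comm, smul_sub, smul_smul]
      module

/-- The coefficients of `recE` as a combination of the `X^{m-k} Y X^k`. -/
def rCoef (α q : 𝕜) : ℕ → ℕ → 𝕜
  | _, 0 => 1
  | 0, _ + 1 => 0
  | m + 1, k + 1 => rCoef α q m (k + 1) - α * q ^ m * rCoef α q m k

theorem rCoef_zero (α q : 𝕜) (m : ℕ) : rCoef α q m 0 = 1 := by cases m <;> rfl

theorem rCoef_gt (α q : 𝕜) (m k : ℕ) (h : m < k) : rCoef α q m k = 0 := by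
  induction m generalizing k with
  | zero => obtain ⟨k, rfl⟩ := Nat.exists_eq_succ_of_ne_zero (by omega : k ≠ 0); rfl
  | succ m ih =>
    obtain ⟨k, rfl⟩ := Nat.exists_eq_succ_of_ne_zero (by omega : k ≠ 0)
    simp [rCoef, ih (k + 1) (by omega), ih k (by omega)]

theorem recE_expand (α q : 𝕜) (X Y : B) (m : ℕ) :
    recE α q X Y m = ∑ k ∈ Finset.range (m + 1), rCoef α q m k • (X ^ (m - k) * Y * X ^ k) := by
  induction m with
  | zero => simp [recE, rCoef]
  | succ m ih =>
    rw [recE_succ, Finset.sum_range_succ']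
    have h1 : X * recE α q X Y m = ∑ k ∈ Finset.range (m + 1),
        rCoef α q m (k + 1) • (X ^ (m - k) * Y * X ^ (k + 1)) + X ^ (m + 1) * Y := by
      have h2 : X * recE α q X Y m = ∑ k ∈ Finset.range (m + 1 + 1),
          rCoef α q m k • (X ^ (m + 1 - k) * Y * X ^ k) := by
        rw [Finset.sum_range_succ, rCoef_gt α q m (m + 1) (by omega), zero_smul, add_zero, ih,
          Finset.mul_sum]
        refine Finset.sum_congr rfl fun k hk => ?_
        have : m + 1 - k = (m - k) + 1 := by have := Finset.mem_range.1 hk; omega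
        rw [this, pow_succ', mul_smul_comm, mul_assoc, mul_assoc, mul_assoc]
      rw [h2, Finset.sum_range_succ']
      simp [rCoef_zero]
    have h3 : recE α q X Y m * X = ∑ k ∈ Finset.range (m + 1),
        rCoef α q m k • (X ^ (m - k) * Y * X ^ (k + 1)) := by
      rw [ih, Finset.sum_mul]
      refine Finset.sum_congr rfl fun k hk => ?_
      rw [smul_mul_assoc, mul_assoc _ (X ^ k), ← pow_succ]
    rw [h1, h3, Finset.smul_sum, add_sub_right_comm, ← Finset.sum_sub_distrib]
    congr 1
    · refine Finset.sum_congr rfl fun k hk => ?_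
      simp only [rCoef, Nat.add_sub_add_right]
      module
    · simp [rCoef_zero]

theorem qNat_add (q : 𝕜) (m n : ℕ) : qNat q (m + n) = qNat q m + q ^ m * qNat q n := by
  induction n with
  | zero => simp [qNat]
  | succ n ih => rw [← add_assoc, qNat_succ, ih, qNat_succ]; ring

theorem qFact_rCoef (α q : 𝕜) (m k : ℕ) :
    qFact q k * rCoef α q m k = (-α) ^ k * q ^ (k.choose 2) * qDesc q m k := by
  induction m generalizing k with
  | zero =>
    cases k with
    | zero => simp [qFact, rCoef, qDesc]
    | succ k => rw [rCoef_gt _ _ _ _ (by omega)]; simp [qDesc, qNat]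
  | succ m ih =>
    cases k with
    | zero => simp [qFact, rCoef, qDesc]
    | succ k =>
      have i1 := ih (k + 1)
      have i2 := ih k
      rw [qDesc_succ', rCoef]
      rw [qDesc_succ] at i1
      rw [qFact_succ] at i1 ⊢
      have ch : (k + 1).choose 2 = k + k.choose 2 := by
        rw [Nat.choose_succ_succ' k 1, Nat.choose_one_right]
      rw [ch, pow_add] at i1 ⊢
      by_cases hk : k ≤ m
      · have e : qNat q (m + 1) = qNat q (m - k) + q ^ (m - k) * qNat q (k + 1) := by
          rw [← qNat_add]; congr 1; omega
        have e2 : q ^ m = q ^ k * q ^ (m - k) := by rw [← pow_add]; congr 1; omega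
        rw [e, e2]
        linear_combination i1 - α * q ^ k * q ^ (m - k) * qNat q (k + 1) * i2
      · have e : qDesc q m k = 0 := by
          apply Finset.prod_eq_zero (i := m) (by simpa using hk)
          simp [qNat]
        rw [rCoef_gt _ _ _ _ (by omega), rCoef_gt _ _ _ _ (by omega), e]
        ring

theorem recE_vanish (α q : 𝕜) (X Y : B) (n : ℕ) (h0 : qNat q (n + 1) = 0)
    (hn : qFact q n ≠ 0) (hX : X ^ (n + 1) = 0) : recE α q X Y (n + 1) = 0 := by
  rw [recE_expand]
  refine Finset.sum_eq_zero fun k hk => ?_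
  rcases Nat.eq_zero_or_pos k with rfl | hk0
  · simp [hX]
  rcases (Nat.lt_succ_iff.1 (Finset.mem_range.1 hk)).eq_or_lt with rfl | hk1
  · simp [hX]
  · have h := qFact_rCoef α q (n + 1) k
    obtain ⟨k, rfl⟩ := Nat.exists_eq_succ_of_ne_zero hk0.ne'
    rw [Nat.succ_eq_add_one, qDesc_succ', h0] at h
    have : qFact q (k + 1) ≠ 0 := by
      unfold qFact at *
      rw [Finset.prod_ne_zero_iff] at *
      intro i hi
      apply hn
      simp at *
      omega
    have h2 : rCoef α q (n + 1) (k + 1) = 0 := by simpa [this] using h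
    simp [h2]

end core

section rep
variable {B : Type*} [Ring B] [Algebra 𝕜 B]

/-- The elements `g x` satisfy the defining relations. -/
structure IsRep (q : I → I → 𝕜) (g : UGen I → B) : Prop where
  comm : ∀ x y : UGen I, x.IsToral → y.IsToral → g x * g y = g y * g x
  KK : ∀ i, g (.K i) * g (.Kinv i) = 1
  LL : ∀ i, g (.L i) * g (.Linv i) = 1
  KE : ∀ i j, QC (q i j) (g (.K i)) (g (.E j))
  LE : ∀ i j, QC (q j i)⁻¹ (g (.L i)) (g (.E j))
  KF : ∀ i j, QC (q i j)⁻¹ (g (.K i)) (g (.F j))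
  LF : ∀ i j, QC (q j i) (g (.L i)) (g (.F j))
  EF : ∀ i j, g (.E i) * g (.F j) - g (.F j) * g (.E i) =
    if i = j then g (.K i) - g (.L i) else 0

/-- The images of the generators under `T_p`. -/
noncomputable def gT (q : I → I → 𝕜) (g : UGen I → B) (p : I) (n : I → ℕ) (lam : I → 𝕜) :
    UGen I → B
  | .K i => if i = p then g (.Kinv p) else g (.K i) * g (.K p) ^ n i
  | .Kinv i => if i = p then g (.K p) else g (.Kinv i) * g (.Kinv p) ^ n i
  | .L i => if i = p then g (.Linv p) else g (.L i) * g (.L p) ^ n i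
  | .Linv i => if i = p then g (.L p) else g (.Linv i) * g (.Linv p) ^ n i
  | .E i => if i = p then g (.F p) * g (.Linv p)
      else recE (q p i) (q p p) (g (.E p)) (g (.E i)) (n i)
  | .F i => if i = p then g (.Kinv p) * g (.E p)
      else (lam i)⁻¹ • recE (q i p) (q p p) (g (.F p)) (g (.F i)) (n i)

theorem QC.congr {c d : 𝕜} {x y : B} (h : QC c x y) (e : c = d) : QC d x y := e ▸ h

theorem IsRep.gT {q q' : I → I → 𝕜} {g : UGen I → B} (H : IsRep q g) (hq : ∀ i j, q i j ≠ 0)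
    (p : I) (n : I → ℕ) (lam : I → 𝕜)
    (hlam : ∀ i, i ≠ p → lam i = qFact (q p p) (n i) * qP (q p p) (q p i) (q i p) (n i))
    (hlam0 : ∀ i, i ≠ p → lam i ≠ 0)
    (hE : ∀ i, i ≠ p → recE (q p i) (q p p) (g (.E p)) (g (.E i)) (n i + 1) = 0)
    (hF : ∀ i, i ≠ p → recE (q i p) (q p p) (g (.F p)) (g (.F i)) (n i + 1) = 0)
    (hpp : q' p p = q p p)
    (hpi : ∀ i, i ≠ p → q' p i = (q p i * q p p ^ n i)⁻¹)
    (hip : ∀ i, i ≠ p → q' i p = (q i p * q p p ^ n i)⁻¹)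
    (hij : ∀ i j, i ≠ p → j ≠ p →
      q' i j = q i j * q p j ^ n i * q i p ^ n j * q p p ^ (n i * n j)) :
    IsRep q' (_root_.gT q g p n lam) := by
  have KK' : ∀ i, g (.Kinv i) * g (.K i) = 1 := fun i => by
    rw [H.comm (.Kinv i) (.K i) trivial trivial, H.KK]
  have LL' : ∀ i, g (.Linv i) * g (.L i) = 1 := fun i => by
    rw [H.comm (.Linv i) (.L i) trivial trivial, H.LL]
  have K'E : ∀ i j, QC (q i j)⁻¹ (g (.Kinv i)) (g (.E j)) := fun i j =>
    (H.KE i j).inv_left (hq _ _) (H.KK i) (KK' i)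
  have K'F : ∀ i j, QC (q i j) (g (.Kinv i)) (g (.F j)) := fun i j =>
    ((H.KF i j).inv_left (inv_ne_zero (hq _ _)) (H.KK i) (KK' i)).congr (inv_inv _)
  have L'E : ∀ i j, QC (q j i) (g (.Linv i)) (g (.E j)) := fun i j =>
    ((H.LE i j).inv_left (inv_ne_zero (hq _ _)) (H.LL i) (LL' i)).congr (inv_inv _)
  have L'F : ∀ i j, QC (q j i)⁻¹ (g (.Linv i)) (g (.F j)) := fun i j =>
    (H.LF i j).inv_left (hq _ _) (H.LL i) (LL' i)
  have tt : ∀ x y : UGen I, x.IsToral → y.IsToral → QC (1 : 𝕜) (g x) (g y) := fun x y hx hy =>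
    QC.of_comm (H.comm x y hx hy)
  have FLi : ∀ x : UGen I, x.IsToral → ∀ c : 𝕜, QC c (g x) (g (.F p)) →
      QC c (g x) (g (.F p) * g (.Linv p)) := fun x hx c h =>
    (h.mul_right (tt x _ hx (by exact trivial))).congr (mul_one _)
  have KiE : ∀ x : UGen I, x.IsToral → ∀ c : 𝕜, QC c (g x) (g (.E p)) →
      QC c (g x) (g (.Kinv p) * g (.E p)) := fun x hx c h =>
    ((tt x _ hx (by exact trivial)).mul_right h).congr (one_mul _)
  have hq0 := hq p p
  constructor
  · -- commutation of the toral part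
    let S : Set B := {b | ∃ x : UGen I, x.IsToral ∧ g x = b}
    have hS : ∀ a ∈ S, ∀ b ∈ S, a * b = b * a := by
      rintro _ ⟨x, hx, rfl⟩ _ ⟨y, hy, rfl⟩
      exact H.comm x y hx hy
    have hmem : ∀ x : UGen I, x.IsToral → g x ∈ Submonoid.closure S := fun x hx =>
      Submonoid.subset_closure ⟨x, hx, rfl⟩
    have hT : ∀ x : UGen I, x.IsToral → _root_.gT q g p n lam x ∈ Submonoid.closure S := by
      intro x hx
      cases x <;> first | exact hx.elim | skip
      all_goals
        simp only [_root_.gT]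
        split_ifs
        · exact hmem _ (by exact trivial)
        · exact mul_mem (hmem _ (by exact trivial)) (pow_mem (hmem _ (by exact trivial)) _)
    intro x y hx hy
    have hc := Submonoid.isMulCommutative_closure B hS
    exact congrArg Subtype.val
      (hc.is_comm.comm (⟨_, hT x hx⟩ : Submonoid.closure S) ⟨_, hT y hy⟩)
  · intro i
    simp only [_root_.gT]
    split_ifs
    · exact KK' p
    · have c1 : Commute (g (.K p)) (g (.Kinv i)) := H.comm _ _ (by exact trivial) (by exact trivial)
      have c2 : Commute (g (.K p)) (g (.Kinv p)) := H.comm _ _ (by exact trivial) (by exact trivial)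
      rw [mul_assoc, ← mul_assoc (_ ^ _), (c1.pow_left _).eq, mul_assoc, ← c2.mul_pow, H.KK,
        one_pow, mul_one, H.KK]
  · intro i
    simp only [_root_.gT]
    split_ifs
    · exact LL' p
    · have c1 : Commute (g (.L p)) (g (.Linv i)) := H.comm _ _ (by exact trivial) (by exact trivial)
      have c2 : Commute (g (.L p)) (g (.Linv p)) := H.comm _ _ (by exact trivial) (by exact trivial)
      rw [mul_assoc, ← mul_assoc (_ ^ _), (c1.pow_left _).eq, mul_assoc, ← c2.mul_pow, H.LL,
        one_pow, mul_one, H.LL]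
  · intro i j
    simp only [_root_.gT]
    split_ifs with h1 h2 h2
    · subst h1; subst h2
      exact (FLi _ (by exact trivial) _ (K'F _ _)).congr hpp.symm
    · subst h1
      refine (QC.recE _ _ (K'E i i) (K'E i j) (n j)).congr ?_
      rw [hpi j h2]; simp [mul_comm]
    · subst h2
      refine ((FLi _ (by exact trivial) _ (H.KF i j)).mul_left
        ((FLi _ (by exact trivial) _ (H.KF j j)).pow_left (n i))).congr ?_
      rw [hip i h1]; simp [mul_comm]
    · refine (((QC.recE _ _ (H.KE i p) (H.KE i j) (n j))).mul_left
        ((QC.recE _ _ (H.KE p p) (H.KE p j) (n j)).pow_left (n i))).congr ?_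
      rw [hij i j h1 h2]; ring
  · intro i j
    simp only [_root_.gT]
    split_ifs with h1 h2 h2
    · subst h1; subst h2
      exact (FLi _ (by exact trivial) _ (L'F _ _)).congr (by rw [hpp])
    · subst h1
      refine (QC.recE _ _ (L'E i i) (L'E i j) (n j)).congr ?_
      rw [hip j h2]; simp
    · subst h2
      refine ((FLi _ (by exact trivial) _ (H.LF i j)).mul_left
        ((FLi _ (by exact trivial) _ (H.LF j j)).pow_left (n i))).congr ?_
      rw [hpi i h1]; simp
    · refine (((QC.recE _ _ (H.LE i p) (H.LE i j) (n j))).mul_left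
        ((QC.recE _ _ (H.LE p p) (H.LE p j) (n j)).pow_left (n i))).congr ?_
      rw [hij j i h2 h1]; simp only [mul_inv, inv_pow]; ring
  · intro i j
    simp only [_root_.gT]
    split_ifs with h1 h2 h2
    · subst h1; subst h2
      exact (KiE _ (by exact trivial) _ (K'E _ _)).congr (by rw [hpp])
    · subst h1
      refine ((QC.recE _ _ (K'F i i) (K'F i j) (n j)).smul_right _).congr ?_
      rw [hpi j h2]; simp
    · subst h2
      refine ((KiE _ (by exact trivial) _ (H.KE i j)).mul_left
        ((KiE _ (by exact trivial) _ (H.KE j j)).pow_left (n i))).congr ?_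
      rw [hip i h1]; simp
    · refine (((QC.recE _ _ (H.KF i p) (H.KF i j) (n j)).smul_right _).mul_left
        (((QC.recE _ _ (H.KF p p) (H.KF p j) (n j)).smul_right _).pow_left (n i))).congr ?_
      rw [hij i j h1 h2]; simp only [mul_inv, inv_pow]; ring
  · intro i j
    simp only [_root_.gT]
    split_ifs with h1 h2 h2
    · subst h1; subst h2
      exact (KiE _ (by exact trivial) _ (L'E _ _)).congr (by rw [hpp])
    · subst h1
      refine ((QC.recE _ _ (L'F i i) (L'F i j) (n j)).smul_right _).congr ?_
      rw [hip j h2]; simp [mul_comm]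
    · subst h2
      refine ((KiE _ (by exact trivial) _ (H.LE i j)).mul_left
        ((KiE _ (by exact trivial) _ (H.LE j j)).pow_left (n i))).congr ?_
      rw [hpi i h1]; simp [mul_comm]
    · refine (((QC.recE _ _ (H.LF i p) (H.LF i j) (n j)).smul_right _).mul_left
        (((QC.recE _ _ (H.LF p p) (H.LF p j) (n j)).smul_right _).pow_left (n i))).congr ?_
      rw [hij j i h2 h1]; ring
  · intro i j
    have EFp := H.EF p p
    rw [if_pos rfl] at EFp
    have EF0 : ∀ i j, i ≠ j → g (.E i) * g (.F j) = g (.F j) * g (.E i) := fun i j h => by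
      have := H.EF i j
      rw [if_neg h] at this
      exact sub_eq_zero.1 this
    have FK : ∀ i j, QC (q i j) (g (.F j)) (g (.K i)) := fun i j =>
      ((H.KF i j).symm (inv_ne_zero (hq _ _))).congr (inv_inv _)
    have EL : ∀ i j, QC (q j i) (g (.E j)) (g (.L i)) := fun i j =>
      ((H.LE i j).symm (inv_ne_zero (hq _ _))).congr (inv_inv _)
    simp only [_root_.gT]
    by_cases h1 : i = p <;> by_cases h2 : j = p
    · subst h1; subst h2
      simp only [if_true]
      have c1 : QC (1 : 𝕜) (g (.Linv j) * g (.Kinv j)) (g (.E j)) :=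
        ((L'E j j).mul_left (K'E j j)).congr (mul_inv_cancel₀ hq0)
      have c2 : QC (1 : 𝕜) (g (.Kinv j)) (g (.E j) * g (.F j)) :=
        ((K'E j j).mul_right (K'F j j)).congr (inv_mul_cancel₀ hq0)
      have c3 := H.comm (.K j) (.Linv j) (by exact trivial) (by exact trivial)
      have c4 := H.comm (.Kinv j) (.Linv j) (by exact trivial) (by exact trivial)
      have c5 := H.LL j
      have c6 := H.KK j
      simp only [QC, one_smul] at c1 c2
      linear_combination (norm := skip) g (.F j) * c1 - c2 * g (.Linv j)
        - EFp * g (.Linv j) * g (.Kinv j) - g (.E j) * g (.F j) * c4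
        - c3 * g (.Kinv j) - g (.Linv j) * c6 + c5 * g (.Kinv j)
      simp only [mul_sub, sub_mul, mul_assoc, mul_one, one_mul]
      abel
    · subst h1
      simp only [if_true, if_neg h2, if_neg (Ne.symm h2)]
      have c1 := QC.recE (q j i) (q i i) (L'F i i) (L'F i j) (n j)
      have c2 := hF j h2
      rw [recE_succ] at c2
      have hc : (q j i)⁻¹ * (q i i)⁻¹ ^ n j * (q j i * q i i ^ n j) = 1 := by
        rw [inv_pow, ← mul_inv, inv_mul_cancel₀ (mul_ne_zero (hq _ _) (pow_ne_zero _ (hq _ _)))]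
      generalize recE (q j i) (q i i) (g (.F i)) (g (.F j)) (n j) = U at *
      generalize q j i * q i i ^ n j = d at *
      generalize (q j i)⁻¹ * (q i i)⁻¹ ^ n j = c at *
      unfold QC at c1
      linear_combination (norm := skip) (lam j)⁻¹ • (g (.F i) * c1 + c • (c2 * g (.Linv i))
        + hc • (U * (g (.F i) * g (.Linv i))))
      simp only [mul_sub, sub_mul, mul_assoc, smul_mul_assoc, mul_smul_comm, smul_sub, smul_smul,
        zero_mul]
      module
    · subst h2
      simp only [if_true, if_neg h1]
      have c1 := QC.recE (q j i) (q j j) (K'E j j) (K'E j i) (n i)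
      have c2 := hE i h1
      rw [recE_succ] at c2
      have hc : (q j i)⁻¹ * (q j j)⁻¹ ^ n i * (q j i * q j j ^ n i) = 1 := by
        rw [inv_pow, ← mul_inv, inv_mul_cancel₀ (mul_ne_zero (hq _ _) (pow_ne_zero _ (hq _ _)))]
      generalize recE (q j i) (q j j) (g (.E j)) (g (.E i)) (n i) = U at *
      generalize q j i * q j j ^ n i = d at *
      generalize (q j i)⁻¹ * (q j j)⁻¹ ^ n i = c at *
      unfold QC at c1
      linear_combination (norm := skip) - g (.Kinv j) * c2 - d • (c1 * g (.E j))
        - hc • (U * (g (.Kinv j) * g (.E j)))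
      simp only [mul_sub, sub_mul, mul_assoc, smul_mul_assoc, mul_smul_comm, smul_sub, smul_smul,
        mul_zero, neg_mul]
      module
    · simp only [if_neg h1, if_neg h2]
      by_cases h : i = j
      · subst h
        rw [if_pos rfl]
        have EFi := H.EF i i
        rw [if_pos rfl] at EFi
        have := (core3 EFp (H.KE p i) (H.KE p p) (H.LF p p) (FK p p) (H.LF p i) (FK p i)
          (hq p i) (hq p p) (EF0 i p h1).symm (EF0 p i (Ne.symm h1)) EFi (FK i p) (H.LF i p)
          (EL i p) (EL p p) (H.comm _ _ (by exact trivial) (by exact trivial)) (H.comm _ _ (by exact trivial) (by exact trivial)) (n i)).2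
        rw [← hlam i h1] at this
        rw [mul_smul_comm, smul_mul_assoc, ← smul_sub, this, smul_smul,
          inv_mul_cancel₀ (hlam0 i h1), one_smul]
      · rw [if_neg h]
        have := core2 EFp (H.KE p i) (H.KE p p) (H.LF p p) (FK p p) (H.LF p j) (FK p j)
          (hq p j) (hq p p) (EF0 i p h1).symm (EF0 p j (Ne.symm h2)) (EF0 i j h) (n i) (n j)
        rw [mul_smul_comm, smul_mul_assoc, ← smul_sub, this, sub_self, smul_zero]

end rep

section final

theorem map_recE {A B : Type*} [Ring A] [Algebra 𝕜 A] [Ring B] [Algebra 𝕜 B] (φ : A →ₐ[𝕜] B)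
    (α β : 𝕜) (X Y : A) (m : ℕ) :
    φ (recE α β X Y m) = recE α β (φ X) (φ Y) m := by
  induction m with
  | zero => rfl
  | succ m ih => simp only [recE_succ, map_sub, map_mul, map_smul, ih]

theorem isRep_mkU (χ : (I → ℤ) → (I → ℤ) → 𝕜) {B : Type*} [Ring B] [Algebra 𝕜 B]
    (φ : UAlg χ →ₐ[𝕜] B) :
    IsRep (fun i j => χ (eps i) (eps j)) (fun x => φ (mkU χ (FreeAlgebra.ι 𝕜 x))) := by
  have key : ∀ {x y}, URel 𝕜 χ x y → φ (mkU χ x) = φ (mkU χ y) := fun h =>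
    congrArg φ (RingQuot.mkAlgHom_rel 𝕜 h)
  constructor
  · intro x y hx hy
    simpa using key (URel.comm x y hx hy)
  · intro i; simpa using key (URel.KKinv i)
  · intro i; simpa using key (URel.LLinv i)
  · intro i j; simpa [QC] using key (URel.KE i j)
  · intro i j; simpa [QC] using key (URel.LE i j)
  · intro i j; simpa [QC] using key (URel.KF i j)
  · intro i j; simpa [QC] using key (URel.LF i j)
  · intro i j
    have := key (URel.EF (χ := χ) i j)
    split_ifs at this ⊢ <;> simpa using this

/-- The algebra map defined by elements satisfying the relations. -/
theorem exists_lift (χ : (I → ℤ) → (I → ℤ) → 𝕜) {B : Type*} [Ring B] [Algebra 𝕜 B]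
    (g : UGen I → B) (H : IsRep (fun i j => χ (eps i) (eps j)) g) :
    ∃ T : UAlg χ →ₐ[𝕜] B, ∀ x, T (mkU χ (FreeAlgebra.ι 𝕜 x)) = g x := by
  have hr : ∀ ⦃x y⦄, URel 𝕜 χ x y → FreeAlgebra.lift 𝕜 g x = FreeAlgebra.lift 𝕜 g y := by
    intro x y h
    induction h with
    | comm x y hx hy => simpa using H.comm x y hx hy
    | KKinv i => simpa using H.KK i
    | LLinv i => simpa using H.LL i
    | KE i j => simpa [QC] using H.KE i j
    | LE i j => simpa [QC] using H.LE i j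
    | KF i j => simpa [QC] using H.KF i j
    | LF i j => simpa [QC] using H.LF i j
    | EF i j =>
      have := H.EF i j
      split_ifs at this ⊢ <;> simpa using this
  refine ⟨RingQuot.liftAlgHom 𝕜 ⟨FreeAlgebra.lift 𝕜 g, hr⟩, fun x => ?_⟩
  simp [mkU]

theorem cartan_spec (χ : (I → ℤ) → (I → ℤ) → 𝕜) (p : I) (hp : IsPFinite χ p) (i : I)
    (hi : i ≠ p) : ∃ n : ℕ, cartan χ p i = -(n : ℤ) ∧
      (qNat (χ (eps p) (eps p)) (n + 1) = 0 ∨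
        χ (eps p) (eps p) ^ n * χ (eps p) (eps i) * χ (eps i) (eps p) = 1) ∧
      ∀ m < n, qNat (χ (eps p) (eps p)) (m + 1) ≠ 0 ∧
        χ (eps p) (eps p) ^ m * χ (eps p) (eps i) * χ (eps i) (eps p) ≠ 1 := by
  classical
  have h := hp i hi
  refine ⟨Nat.find h, ?_, Nat.find_spec h, fun m hm => ?_⟩
  · unfold cartan
    rw [if_neg (Ne.symm hi), dif_pos h]
  · exact not_or.1 (Nat.find_min h hm)

theorem sigma_p (χ : (I → ℤ) → (I → ℤ) → 𝕜) (p : I) : sigmaChi χ p (eps p) = - eps p := by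
  have : ∑ j, cartan χ p j * (eps p : I → ℤ) j = 2 := by
    simp [eps, Pi.single_apply, cartan]
  rw [sigmaChi, this]
  module

theorem sigma_i (χ : (I → ℤ) → (I → ℤ) → 𝕜) (p i : I) (n : ℕ) (h : cartan χ p i = -(n : ℤ)) :
    sigmaChi χ p (eps i) = eps i + n • eps p := by
  have : ∑ j, cartan χ p j * (eps i : I → ℤ) j = -n := by
    simp [eps, Pi.single_apply, h]
  rw [sigmaChi, this]
  simp

theorem bichar_neg {χ : (I → ℤ) → (I → ℤ) → 𝕜} (hχ : IsBichar χ) (a b : I → ℤ) :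
    χ (-a) b = (χ a b)⁻¹ ∧ χ a (-b) = (χ a b)⁻¹ := by
  obtain ⟨h1, h2, h3⟩ := hχ
  have z1 : χ 0 b = 1 := by
    have := h1 0 0 b
    rw [add_zero] at this
    exact (mul_eq_left₀ (h3 0 b)).1 this.symm
  have z2 : χ a 0 = 1 := by
    have := h2 a 0 0
    rw [add_zero] at this
    exact (mul_eq_left₀ (h3 a 0)).1 this.symm
  constructor
  · exact eq_inv_of_mul_eq_one_left (by rw [← h1, neg_add_cancel, z1])
  · exact eq_inv_of_mul_eq_one_left (by rw [← h2, neg_add_cancel, z2])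

theorem bichar_add_nsmul {χ : (I → ℤ) → (I → ℤ) → 𝕜} (hχ : IsBichar χ) (a b c : I → ℤ) (n : ℕ) :
    χ (a + n • b) c = χ a c * χ b c ^ n ∧ χ c (a + n • b) = χ c a * χ c b ^ n := by
  obtain ⟨h1, h2, h3⟩ := hχ
  induction n with
  | zero => simp
  | succ n ih =>
    rw [succ_nsmul, ← add_assoc, h1, h2, ih.1, ih.2]
    constructor <;> ring

theorem lam_ne {q r : 𝕜} (hq : q ≠ 0) (n : ℕ) (h : qNat q (n + 1) = 0 ∨ q ^ n * r = 1)
    (hm : ∀ m < n, qNat q (m + 1) ≠ 0 ∧ q ^ m * r ≠ 1) (s : ℕ) (hs : s < n) :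
    q ^ (2 * n - s) * r ≠ 1 := by
  have geom : ∀ k, (q - 1) * qNat q k = q ^ k - 1 := fun k => by
    have h1 := qNat_succ q k
    rw [qNat_succ'] at h1
    linear_combination h1
  intro h1
  rcases h with h | h
  · have h2 := geom (n + 1)
    rw [h] at h2
    have h3 : q ^ (n + 1) = 1 := by linear_combination - h2
    apply (hm (n - s - 1) (by omega)).2
    have e : 2 * n - s = (n + 1) + (n - s - 1) := by omega
    rw [e, pow_add, h3, one_mul] at h1
    exact h1
  · have e : 2 * n - s = (n - s - 1 + 1) + n := by omega
    rw [e, pow_add, mul_assoc, h, mul_one] at h1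
    have h2 := geom (n - s - 1 + 1)
    rw [h1, sub_self] at h2
    rcases mul_eq_zero.1 h2 with h3 | h3
    · have hq1 : q = 1 := sub_eq_zero.1 h3
      subst hq1
      apply (hm 0 (by omega)).2
      simpa using h
    · exact (hm _ (by omega)).1 h3

end final

/-- Lemma (le:Lusztig1) for `T_p`: if `χ` is `p`-finite and `χ̄ = r_p(χ)`,
then `λ_i(χ̄) ≠ 0` for all `i ≠ p`, and there is a unique algebra map
`T_p : 𝒰(χ) → 𝒰(χ̄)/(I_p^+(χ̄), I_p^-(χ̄))` with the prescribed values on the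
generators. -/
theorem lusztig_map_exists_unique (χ : (I → ℤ) → (I → ℤ) → 𝕜)
    (hχ : IsBichar χ) (p : I) (hp : IsPFinite χ p) :
    (∀ i, i ≠ p → lamOf (rp χ p) p i (-(cartan χ p i)).toNat ≠ 0) ∧
    ∃! T : UAlg χ →ₐ[𝕜] UQuot (rp χ p) p (fun i => cartan χ p i),
      T (uK χ p) = mkJ (rp χ p) p (fun i => cartan χ p i) (uKinv (rp χ p) p) ∧
      T (uL χ p) = mkJ (rp χ p) p (fun i => cartan χ p i) (uLinv (rp χ p) p) ∧
      (∀ i, i ≠ p → T (uK χ i) =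
        mkJ (rp χ p) p (fun i => cartan χ p i)
          (uK (rp χ p) i * uK (rp χ p) p ^ (-(cartan χ p i)).toNat)) ∧
      (∀ i, i ≠ p → T (uL χ i) =
        mkJ (rp χ p) p (fun i => cartan χ p i)
          (uL (rp χ p) i * uL (rp χ p) p ^ (-(cartan χ p i)).toNat)) ∧
      T (uE χ p) = mkJ (rp χ p) p (fun i => cartan χ p i)
        (uF (rp χ p) p * uLinv (rp χ p) p) ∧
      T (uF χ p) = mkJ (rp χ p) p (fun i => cartan χ p i)
        (uKinv (rp χ p) p * uE (rp χ p) p) ∧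
      (∀ i, i ≠ p → T (uE χ i) =
        mkJ (rp χ p) p (fun i => cartan χ p i)
          (recE (rp χ p (eps p) (eps i)) (rp χ p (eps p) (eps p))
            (uE (rp χ p) p) (uE (rp χ p) i) (-(cartan χ p i)).toNat)) ∧
      (∀ i, i ≠ p → T (uF χ i) =
        (lamOf (rp χ p) p i (-(cartan χ p i)).toNat)⁻¹ •
          mkJ (rp χ p) p (fun i => cartan χ p i)
            (recE (rp χ p (eps i) (eps p)) (rp χ p (eps p) (eps p))
              (uF (rp χ p) p) (uF (rp χ p) i) (-(cartan χ p i)).toNat)) := by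
  classical
  choose! n hn hn1 hn2 using cartan_spec χ p hp
  have hnt : ∀ i, i ≠ p → (-(cartan χ p i)).toNat = n i := fun i hi => by
    rw [hn i hi]; simp
  have hnt1 : ∀ i, i ≠ p → ((1 : ℤ) - cartan χ p i).toNat = n i + 1 := fun i hi => by
    rw [hn i hi]; omega
  have h0 := hχ.2.2
  -- values of `rp χ p`
  have rpp : rp χ p (eps p) (eps p) = χ (eps p) (eps p) := by
    rw [rp, sigma_p, (bichar_neg hχ _ _).1, (bichar_neg hχ _ _).2, inv_inv]
  have rpi : ∀ i, i ≠ p → rp χ p (eps p) (eps i) =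
      (χ (eps p) (eps i) * χ (eps p) (eps p) ^ n i)⁻¹ := fun i hi => by
    rw [rp, sigma_p, sigma_i χ p i _ (hn i hi), (bichar_neg hχ _ _).1,
      (bichar_add_nsmul hχ _ _ _ _).2]
  have rip : ∀ i, i ≠ p → rp χ p (eps i) (eps p) =
      (χ (eps i) (eps p) * χ (eps p) (eps p) ^ n i)⁻¹ := fun i hi => by
    rw [rp, sigma_p, sigma_i χ p i _ (hn i hi), (bichar_neg hχ _ _).2,
      (bichar_add_nsmul hχ _ _ _ _).1]
  have rij : ∀ i j, i ≠ p → j ≠ p → rp χ p (eps i) (eps j) =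
      χ (eps i) (eps j) * χ (eps i) (eps p) ^ n j *
        (χ (eps p) (eps j) * χ (eps p) (eps p) ^ n j) ^ n i := fun i j hi hj => by
    rw [rp, sigma_i χ p i _ (hn i hi), sigma_i χ p j _ (hn j hj),
      (bichar_add_nsmul hχ _ _ _ _).1, (bichar_add_nsmul hχ _ _ _ _).2,
      (bichar_add_nsmul hχ _ _ _ _).2]
  have r0 : ∀ i j, rp χ p (eps i) (eps j) ≠ 0 := fun i j => h0 _ _
  have hfact : ∀ i, i ≠ p → qFact (χ (eps p) (eps p)) (n i) ≠ 0 := fun i hi => by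
    unfold qFact
    rw [Finset.prod_ne_zero_iff]
    exact fun m hm => (hn2 i hi m (Finset.mem_range.1 hm)).1
  have hlam0 : ∀ i, i ≠ p → lamOf (rp χ p) p i (n i) ≠ 0 := by
    intro i hi
    unfold lamOf
    rw [rpp, rpi i hi, rip i hi]
    refine mul_ne_zero (hfact i hi) (Finset.prod_ne_zero_iff.2 fun s hs hz => ?_)
    have hs := Finset.mem_range.1 hs
    have hq := h0 (eps p) (eps p)
    have ha := h0 (eps p) (eps i)
    have hb := h0 (eps i) (eps p)
    refine lam_ne (r := χ (eps p) (eps i) * χ (eps i) (eps p)) hq (n i)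
      (by simpa only [mul_assoc] using hn1 i hi)
      (fun m hm => by simpa only [mul_assoc] using hn2 i hi m hm) s hs ?_
    generalize χ (eps p) (eps p) = q at *
    generalize χ (eps p) (eps i) = a at *
    generalize χ (eps i) (eps p) = b at *
    have e : q ^ n i * q ^ n i = q ^ (2 * n i - s) * q ^ s := by
      rw [← pow_add, ← pow_add]; congr 1; omega
    field_simp at hz
    have hz' : q ^ s = a * b * (q ^ n i * q ^ n i) := by linear_combination hz
    rw [e] at hz'
    have : q ^ s * (q ^ (2 * n i - s) * (a * b)) = q ^ s * 1 := by linear_combination - hz'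
    exact mul_left_cancel₀ (pow_ne_zero _ hq) this
  refine ⟨fun i hi => by rw [hnt i hi]; exact hlam0 i hi, ?_⟩
  have hmap : ∀ (α β : 𝕜) (X Y : UAlg (rp χ p)) (m : ℕ),
      mkJ (rp χ p) p (fun i => cartan χ p i) (recE α β X Y m) =
        recE α β (mkJ (rp χ p) p (fun i => cartan χ p i) X)
          (mkJ (rp χ p) p (fun i => cartan χ p i) Y) m :=
    map_recE (A := UAlg (rp χ p)) (B := UQuot (rp χ p) p (fun i => cartan χ p i)) _
  have H := isRep_mkU (B := UQuot (rp χ p) p (fun i => cartan χ p i)) (rp χ p) (mkJ (rp χ p) p (fun i => cartan χ p i))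
  have hJ : ∀ x ∈ genSet (rp χ p) p (fun i => cartan χ p i),
      mkJ (rp χ p) p (fun i => cartan χ p i) x = 0 := fun x hx => by
    rw [← map_zero (mkJ (rp χ p) p (fun i => cartan χ p i))]
    exact RingQuot.mkAlgHom_rel 𝕜 (⟨hx, rfl⟩ : JRel _ _ _ _ _)
  have hEF : ∀ i, i ≠ p →
      mkJ (rp χ p) p (fun i => cartan χ p i) (recE (rp χ p (eps p) (eps i))
        (rp χ p (eps p) (eps p)) (uE (rp χ p) p) (uE (rp χ p) i) (n i + 1)) = 0 ∧
      mkJ (rp χ p) p (fun i => cartan χ p i) (recE (rp χ p (eps i) (eps p))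
        (rp χ p (eps p) (eps p)) (uF (rp χ p) p) (uF (rp χ p) i) (n i + 1)) = 0 := by
    intro i hi
    by_cases h : ∃ m : ℕ, 0 < m ∧ qNat (rp χ p (eps p) (eps p)) m = 0
    · by_cases hlt : n i + 1 < Nat.find h
      · constructor
        · apply hJ
          rw [genSet, dif_pos h]
          refine Or.inr ⟨i, hi, ?_, ?_⟩
          · rw [hnt1 i hi]; exact hlt
          · left; rw [hnt1 i hi]
        · apply hJ
          rw [genSet, dif_pos h]
          refine Or.inr ⟨i, hi, ?_, ?_⟩
          · rw [hnt1 i hi]; exact hlt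
          · right; rw [hnt1 i hi]
      · have hs := Nat.find_spec h
        have heq : Nat.find h = n i + 1 := by
          by_contra hne
          have h3 := (hn2 i hi (Nat.find h - 1) (by omega)).1
          rw [Nat.sub_add_cancel hs.1, ← rpp] at h3
          exact h3 hs.2
        have hE0 : mkJ (rp χ p) p (fun i => cartan χ p i) (uE (rp χ p) p ^ (n i + 1)) = 0 := by
          apply hJ
          rw [genSet, dif_pos h, ← heq]
          exact Or.inl (Or.inl rfl)
        have hF0 : mkJ (rp χ p) p (fun i => cartan χ p i) (uF (rp χ p) p ^ (n i + 1)) = 0 := by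
          apply hJ
          rw [genSet, dif_pos h, ← heq]
          exact Or.inl (Or.inr rfl)
        have hz : qNat (rp χ p (eps p) (eps p)) (n i + 1) = 0 := heq ▸ hs.2
        have hf : qFact (rp χ p (eps p) (eps p)) (n i) ≠ 0 := rpp ▸ hfact i hi
        rw [map_pow] at hE0 hF0
        rw [hmap, hmap]
        exact ⟨recE_vanish _ _ _ _ _ hz hf hE0, recE_vanish _ _ _ _ _ hz hf hF0⟩
    · constructor
      · apply hJ
        rw [genSet, dif_neg h]
        refine ⟨i, hi, ?_⟩
        left; rw [hnt1 i hi]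
      · apply hJ
        rw [genSet, dif_neg h]
        refine ⟨i, hi, ?_⟩
        right; rw [hnt1 i hi]
  have HT := H.gT (q' := fun i j => χ (eps i) (eps j)) r0 p n
    (fun i => lamOf (rp χ p) p i (n i)) (fun i hi => rfl) hlam0
    (fun i hi => by
      have := (hEF i hi).1
      rw [hmap] at this
      exact this)
    (fun i hi => by
      have := (hEF i hi).2
      rw [hmap] at this
      exact this)
    rpp.symm
    (fun i hi => by
      have ha := h0 (eps p) (eps i)
      have hq := h0 (eps p) (eps p)
      simp only [rpp, rpi i hi]
      field_simp)
    (fun i hi => by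
      have ha := h0 (eps i) (eps p)
      have hq := h0 (eps p) (eps p)
      simp only [rpp, rip i hi]
      field_simp)
    (fun i j hi hj => by
      have ha := h0 (eps i) (eps p)
      have hb := h0 (eps p) (eps j)
      have hq := h0 (eps p) (eps p)
      simp only [rpp, rip i hi, rpi j hj, rij i j hi hj, mul_inv, mul_pow, inv_pow, ← pow_mul,
        mul_comm (n j) (n i)]
      field_simp)
  obtain ⟨T, hT⟩ := exists_lift χ _ HT
  refine ⟨T, ⟨?_, ?_, ?_, ?_, ?_, ?_, ?_, ?_⟩, ?_⟩
  · refine (hT _).trans ?_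
    simp [gT, uKinv]
  · refine (hT _).trans ?_
    simp [gT, uLinv]
  · intro i hi
    refine (hT _).trans ?_
    simp [gT, hi, uK, hnt i hi]
  · intro i hi
    refine (hT _).trans ?_
    simp [gT, hi, uL, hnt i hi]
  · refine (hT _).trans ?_
    simp [gT, uF, uLinv]
  · refine (hT _).trans ?_
    simp [gT, uE, uKinv]
  · intro i hi
    refine (hT _).trans ?_
    simp [gT, hi, uE, hnt i hi, hmap]
  · intro i hi
    refine (hT _).trans ?_
    simp [gT, hi, uF, hnt i hi, hmap]
  · rintro T' ⟨t1, t2, t3, t4, t5, t6, t7, t8⟩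
    have HT' := isRep_mkU (B := UQuot (rp χ p) p (fun i => cartan χ p i)) χ T'
    have HT0 := isRep_mkU (B := UQuot (rp χ p) p (fun i => cartan χ p i)) χ T
    have hinv : ∀ {R : Type _} [Ring R] {x y y' : R}, x * y = 1 → y * x = 1 → x * y' = 1 → y' = y :=
      fun {R} _ {x y y'} h1 h2 h3 => (left_inv_eq_right_inv h2 h3).symm
    have K1 : ∀ i, T' (uK χ i) = T (uK χ i) := by
      intro i
      rw [uK, hT]
      by_cases hi : i = p
      · subst hi; rw [← uK, t1]; simp [gT, uKinv]
      · rw [← uK, t3 i hi]; simp [gT, hi, uK, hnt i hi]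
    have L1 : ∀ i, T' (uL χ i) = T (uL χ i) := by
      intro i
      rw [uL, hT]
      by_cases hi : i = p
      · subst hi; rw [← uL, t2]; simp [gT, uLinv]
      · rw [← uL, t4 i hi]; simp [gT, hi, uL, hnt i hi]
    apply RingQuot.ringQuot_ext'
    apply FreeAlgebra.hom_ext
    funext x
    change T' (mkU χ (FreeAlgebra.ι 𝕜 x)) = T (mkU χ (FreeAlgebra.ι 𝕜 x))
    cases x with
    | K i => exact K1 i
    | L i => exact L1 i
    | Kinv i =>
      refine hinv (HT0.KK i) ?_ ?_
      · exact (HT0.comm (.Kinv i) (.K i) trivial trivial).trans (HT0.KK i)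
      · have := HT'.KK i
        have k := K1 i
        rw [uK] at k
        rwa [k] at this
    | Linv i =>
      refine hinv (HT0.LL i) ?_ ?_
      · exact (HT0.comm (.Linv i) (.L i) trivial trivial).trans (HT0.LL i)
      · have := HT'.LL i
        have k := L1 i
        rw [uL] at k
        rwa [k] at this
    | E i =>
      rw [hT]
      by_cases hi : i = p
      · subst hi; rw [← uE, t5]; simp [gT, uF, uLinv]
      · rw [← uE, t7 i hi]; simp [gT, hi, uE, hnt i hi, hmap]
    | F i =>
      rw [hT]
      by_cases hi : i = p
      · subst hi; rw [← uF, t6]; simp [gT, uE, uKinv]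
      · rw [← uF, t8 i hi]; simp [gT, hi, uF, hnt i hi, hmap]
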